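/- arXiv:2511.11264 — 8 statements merged into one kernel-verified Lean document; each statement's English description precedes it below -/
import Mathlib

section
/- Fundamental theorem of Kleene Algebra (semantic form): for every regular expression e over a finite alphabet A, the language ⟦e⟧ equals the union of ⟦o(e)⟧ (which is {ε} if o(e) = 1 and ∅ if o(e) = 0) with the union over all letters a ∈ A of the languages {a}·⟦e_a⟧. -/
open RegularExpression

/-- A word lies in the union of the languages `{a}·L a` exactly when it is a letter `a`
followed by a word of `L a`. -/
theorem mem_iSup_singleton_mul_iff {A : Type*} (L : A → Language A) (x : List A) :
    x ∈ ⨆ a : A, ({[a]} : Language A) * L a ↔ ∃ a, ∃ y ∈ L a, a :: y = x := by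
  rw [Language.mem_iSup]
  refine exists_congr fun a => ?_
  rw [Language.mem_mul]
  constructor
  · rintro ⟨_, rfl, y, hy, rfl⟩
    exact ⟨y, hy, rfl⟩
  · rintro ⟨y, hy, rfl⟩
    exact ⟨[a], rfl, y, hy, rfl⟩

/-- Fundamental theorem of Kleene Algebra, semantic form: `⟦e⟧` is the union of
`⟦o(e)⟧` (which is `{ε}` i.e. `1` if `o(e) = 1` and `∅` i.e. `0` otherwise) with the
union over all letters `a` of the languages `{a}·⟦e_a⟧`. -/
theorem fundamental_theorem_semantic {A : Type*} [Fintype A] [DecidableEq A]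
    (e : RegularExpression A) :
    e.matches' =
      (if e.matchEpsilon then (1 : Language A) else (0 : Language A)) +
        ⨆ a : A, ({[a]} : Language A) * (e.deriv a).matches' := by
  ext x
  rw [Language.mem_add, mem_iSup_singleton_mul_iff]
  cases x with
  | nil =>
    rw [← rmatch_iff_matches', rmatch]
    cases e.matchEpsilon <;> simp [Language.notMem_zero]
  | cons b y =>
    rw [← rmatch_iff_matches', rmatch, rmatch_iff_matches']
    cases e.matchEpsilon <;> simp [Language.notMem_zero, Language.mem_one]
end

section
/- The ACI congruence is a bisimulation on the Brzozowski automaton: for all regular expressions e, f over a finite alphabet A, if e ≅ f then o(e) = o(f) and e_a ≅ f_a for every letter a ∈ A. -/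
/-- The ACI congruence: the smallest congruence on regular expressions (w.r.t. `+`, `·`
and `*`) satisfying associativity, commutativity and idempotence of `+`. -/
inductive ACI {A : Type*} : RegularExpression A → RegularExpression A → Prop
  | assoc (e f g : RegularExpression A) : ACI (e + (f + g)) ((e + f) + g)
  | comm (e f : RegularExpression A) : ACI (e + f) (f + e)
  | idem (e : RegularExpression A) : ACI (e + e) e
  | refl (e : RegularExpression A) : ACI e e
  | symm {e f : RegularExpression A} : ACI e f → ACI f e
  | trans {e f g : RegularExpression A} : ACI e f → ACI f g → ACI e g
  | add_congr {e e' f f' : RegularExpression A} :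
      ACI e e' → ACI f f' → ACI (e + f) (e' + f')
  | mul_congr {e e' f f' : RegularExpression A} :
      ACI e e' → ACI f f' → ACI (e * f) (e' * f')
  | star_congr {e e' : RegularExpression A} : ACI e e' → ACI e.star e'.star

/-- The iterated Brzozowski word derivative `e_w`. -/
def wordDeriv {A : Type*} [DecidableEq A] (e : RegularExpression A) (w : List A) :
    RegularExpression A :=
  w.foldl RegularExpression.deriv e

/-- The Brzozowski output of a sum is the disjunction of the outputs. -/
theorem matchEpsilon_add {A : Type*} (e f : RegularExpression A) :
    (e + f).matchEpsilon = (e.matchEpsilon || f.matchEpsilon) :=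
  rfl

/-- The Brzozowski output of a product is the conjunction of the outputs. -/
theorem matchEpsilon_mul {A : Type*} (e f : RegularExpression A) :
    (e * f).matchEpsilon = (e.matchEpsilon && f.matchEpsilon) :=
  rfl

/-- The Brzozowski derivative of a product. -/
theorem deriv_mul_eq_ite {A : Type*} [DecidableEq A] (e f : RegularExpression A) (a : A) :
    (e * f).deriv a =
      if e.matchEpsilon then e.deriv a * f + f.deriv a else e.deriv a * f :=
  rfl

/-- The ACI congruence is a bisimulation on the Brzozowski automaton. -/
theorem aci_is_bisimulation {A : Type*} [Fintype A] [DecidableEq A]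
    (e f : RegularExpression A) (h : ACI e f) :
    e.matchEpsilon = f.matchEpsilon ∧ ∀ a : A, ACI (e.deriv a) (f.deriv a) := by
  induction h with
  | assoc e f g => exact ⟨by simp [matchEpsilon_add, Bool.or_assoc], fun a => .assoc _ _ _⟩
  | comm e f => exact ⟨by simp [matchEpsilon_add, Bool.or_comm], fun a => .comm _ _⟩
  | idem e => exact ⟨by simp [matchEpsilon_add], fun a => .idem _⟩
  | refl e => exact ⟨rfl, fun a => .refl _⟩
  | symm _ ih => exact ⟨ih.1.symm, fun a => (ih.2 a).symm⟩
  | trans _ _ ih₁ ih₂ => exact ⟨ih₁.1.trans ih₂.1, fun a => (ih₁.2 a).trans (ih₂.2 a)⟩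
  | add_congr _ _ ih₁ ih₂ =>
    exact ⟨by simp [matchEpsilon_add, ih₁.1, ih₂.1], fun a => .add_congr (ih₁.2 a) (ih₂.2 a)⟩
  | @mul_congr e e' f f' _ h₂ ih₁ ih₂ =>
    refine ⟨by simp [matchEpsilon_mul, ih₁.1, ih₂.1], fun a => ?_⟩
    rw [deriv_mul_eq_ite, deriv_mul_eq_ite, ih₁.1]
    split_ifs
    · exact .add_congr (.mul_congr (ih₁.2 a) h₂) (ih₂.2 a)
    · exact .mul_congr (ih₁.2 a) h₂
  | star_congr h ih => exact ⟨rfl, fun a => .mul_congr (ih.2 a) (.star_congr h)⟩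
end

section
/- For every non-empty word w ∈ A* and all regular expressions e₁, e₂ over a finite alphabet A, there exist m ≥ 0 and words x₁, …, x_m ∈ A* such that the word derivative of the product satisfies (e₁·e₂)_w ≅ (e₁)_w·e₂ + (e₂)_{x₁} + ⋯ + (e₂)_{x_m}, where ≅ is the ACI congruence (when m = 0, the right-hand side is just (e₁)_w·e₂). -/
theorem wordDeriv_add {A : Type*} [DecidableEq A] (e f : RegularExpression A) (w : List A) :
    wordDeriv (e + f) w = wordDeriv e w + wordDeriv f w := by
  induction w generalizing e f with
  | nil => rfl
  | cons a w ih => exact ih (e.deriv a) (f.deriv a)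

/-- The expansion of a product derivative holds syntactically, and also for the empty word. -/
theorem exists_wordDeriv_mul_eq {A : Type*} [DecidableEq A]
    (w : List A) (e₁ e₂ : RegularExpression A) :
    ∃ xs : List (List A),
      wordDeriv (e₁ * e₂) w =
        xs.foldl (fun acc x => acc + wordDeriv e₂ x) (wordDeriv e₁ w * e₂) := by
  induction w generalizing e₁ with
  | nil => exact ⟨[], rfl⟩
  | cons a w ih =>
    obtain ⟨xs, hxs⟩ := ih (e₁.deriv a)
    have hstep : wordDeriv (e₁ * e₂) (a :: w) = wordDeriv ((e₁ * e₂).deriv a) w := rfl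
    have hderiv : (e₁ * e₂).deriv a =
        if e₁.matchEpsilon then e₁.deriv a * e₂ + e₂.deriv a else e₁.deriv a * e₂ := rfl
    by_cases h : e₁.matchEpsilon
    · refine ⟨xs ++ [a :: w], ?_⟩
      rw [hstep, hderiv, if_pos h, wordDeriv_add, hxs, List.foldl_append]
      rfl
    · refine ⟨xs, ?_⟩
      rw [hstep, hderiv, if_neg h, hxs]
      rfl

/-- Word derivative of a product, up to ACI: there exist `m ≥ 0` words `x₁, …, x_m` with
`(e₁·e₂)_w ≅ (e₁)_w·e₂ + (e₂)_{x₁} + ⋯ + (e₂)_{x_m}`. -/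
theorem wordDeriv_mul {A : Type*} [Fintype A] [DecidableEq A]
    (w : List A) (hw : w ≠ []) (e₁ e₂ : RegularExpression A) :
    ∃ xs : List (List A),
      ACI (wordDeriv (e₁ * e₂) w)
        (xs.foldl (fun acc x => acc + wordDeriv e₂ x) (wordDeriv e₁ w * e₂)) := by
  obtain ⟨xs, hxs⟩ := exists_wordDeriv_mul_eq w e₁ e₂
  exact ⟨xs, hxs ▸ ACI.refl _⟩
end

section
/- For every non-empty word w ∈ A* and every regular expression e over a finite alphabet A, there exist n ≥ 1 and words y₁, …, y_n ∈ A* such that the word derivative of the star satisfies (e*)_w ≅ e_{y₁}·e* + ⋯ + e_{y_n}·e*, where ≅ is the ACI congruence. -/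
/-- `IsDerivSum e f` says that `f` is a sum, bracketed in any way, of expressions
`e_y · e*`. -/
inductive IsDerivSum {A : Type*} [DecidableEq A] (e : RegularExpression A) :
    RegularExpression A → Prop
  | base (y : List A) : IsDerivSum e (wordDeriv e y * e.star)
  | add {f g : RegularExpression A} :
      IsDerivSum e f → IsDerivSum e g → IsDerivSum e (f + g)

theorem IsDerivSum.deriv {A : Type*} [DecidableEq A] {e f : RegularExpression A}
    (hf : IsDerivSum e f) (a : A) : IsDerivSum e (f.deriv a) := by
  induction hf with
  | base y =>
    have hy : IsDerivSum e ((wordDeriv e y).deriv a * e.star) := by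
      simpa [wordDeriv] using IsDerivSum.base (e := e) (y ++ [a])
    change IsDerivSum e (if (wordDeriv e y).matchEpsilon then
      (wordDeriv e y).deriv a * e.star + e.deriv a * e.star
      else (wordDeriv e y).deriv a * e.star)
    split
    · exact hy.add (IsDerivSum.base [a])
    · exact hy
  | add _ _ ihf ihg => exact ihf.add ihg

theorem IsDerivSum.wordDeriv {A : Type*} [DecidableEq A] {e f : RegularExpression A}
    (hf : IsDerivSum e f) (w : List A) : IsDerivSum e (wordDeriv f w) := by
  induction w generalizing f with
  | nil => exact hf
  | cons a w ih => exact ih (hf.deriv a)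

theorem ACI.add_foldl {A ι : Type*} (t : ι → RegularExpression A) (l : List ι)
    (f g : RegularExpression A) :
    ACI (f + l.foldl (fun acc z => acc + t z) g)
      (l.foldl (fun acc z => acc + t z) (f + g)) := by
  induction l using List.reverseRecOn with
  | nil => exact .refl _
  | append_singleton l z ih =>
    simp only [List.foldl_append, List.foldl_cons, List.foldl_nil]
    exact (ACI.assoc _ _ _).trans (ih.add_congr (.refl _))

/-- Up to `ACI`, every sum of expressions `e_y · e*` can be bracketed to the left. -/
theorem IsDerivSum.exists_foldl {A : Type*} [DecidableEq A] {e f : RegularExpression A}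
    (hf : IsDerivSum e f) :
    ∃ (y : List A) (ys : List (List A)),
      ACI f (ys.foldl (fun acc z => acc + _root_.wordDeriv e z * e.star)
        (_root_.wordDeriv e y * e.star)) := by
  induction hf with
  | base y => exact ⟨y, [], .refl _⟩
  | add _ _ ihf ihg =>
    obtain ⟨y, ys, hy⟩ := ihf
    obtain ⟨z, zs, hz⟩ := ihg
    refine ⟨y, ys ++ z :: zs, (hy.add_congr hz).trans ?_⟩
    rw [List.foldl_append, List.foldl_cons]
    exact ACI.add_foldl _ _ _ _

/-- Word derivative of a star, up to ACI: there exist `n ≥ 1` words `y₁, …, y_n` with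
`(e*)_w ≅ e_{y₁}·e* + ⋯ + e_{y_n}·e*`. -/
theorem wordDeriv_star {A : Type*} [Fintype A] [DecidableEq A]
    (w : List A) (hw : w ≠ []) (e : RegularExpression A) :
    ∃ (y : List A) (ys : List (List A)),
      ACI (wordDeriv e.star w)
        (ys.foldl (fun acc z => acc + wordDeriv e z * e.star)
          (wordDeriv e y * e.star)) := by
  cases w with
  | nil => exact absurd rfl hw
  | cons a w =>
    exact ((IsDerivSum.base (e := e) [a]).wordDeriv w).exists_foldl
end

section
/- Finiteness of Brzozowski derivatives modulo ACI: for every regular expression e over a finite alphabet A, there exists a finite set ρ(e) of regular expressions such that for every word w ∈ A*, the word derivative e_w is ACI-equivalent to some e' ∈ ρ(e), i.e., e_w ≅ e'. -/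
namespace ACI

variable {A : Type*}

/-- The ACI congruence as a setoid. -/
def setoid (A : Type*) : Setoid (RegularExpression A) where
  r := ACI
  iseqv := ⟨ACI.refl, ACI.symm, ACI.trans⟩

/-- Regular expressions modulo the ACI congruence. -/
abbrev Class (A : Type*) : Type _ := Quotient (setoid A)

/-- The class of a regular expression modulo ACI. -/
def toClass (e : RegularExpression A) : Class A := Quotient.mk (setoid A) e

theorem toClass_eq_iff {e f : RegularExpression A} : toClass e = toClass f ↔ ACI e f :=
  Quotient.eq (r := setoid A)

/-- Union makes the ACI classes a join semilattice. -/
instance : SemilatticeSup (Class A) :=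
  letI : Max (Class A) :=
    ⟨Quotient.map₂ (· + ·) fun _ _ he _ _ hf => ACI.add_congr he hf⟩
  SemilatticeSup.mk'
    (by
      rintro ⟨e⟩ ⟨f⟩
      exact toClass_eq_iff.2 (.comm e f))
    (by
      rintro ⟨e⟩ ⟨f⟩ ⟨g⟩
      exact toClass_eq_iff.2 (.symm (.assoc e f g)))
    (by
      rintro ⟨e⟩
      exact toClass_eq_iff.2 (.idem e))

/-- Finite sums of elements of `S` have finitely many classes as soon as `S` does. -/
theorem finite_toClass_image_closure {S : Set (RegularExpression A)}
    (hS : (toClass '' S).Finite) :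
    (toClass '' (AddSubsemigroup.closure S : Set (RegularExpression A))).Finite := by
  refine hS.supClosure.subset ?_
  rintro _ ⟨e, he, rfl⟩
  induction he using AddSubsemigroup.closure_induction with
  | mem e he => exact subset_supClosure (Set.mem_image_of_mem _ he)
  | add e f _ _ he hf => exact supClosed_supClosure he hf

theorem finite_toClass_range_mul {ι : Type*} {u : ι → RegularExpression A}
    (hu : (toClass '' Set.range u).Finite) (f : RegularExpression A) :
    (toClass '' Set.range fun i => u i * f).Finite := by
  let mulRight : Class A → Class A :=
    Quotient.map (· * f) fun _ _ h => ACI.mul_congr h (.refl f)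
  refine (hu.image mulRight).subset ?_
  rintro _ ⟨_, ⟨i, rfl⟩, rfl⟩
  exact ⟨toClass (u i), ⟨_, ⟨i, rfl⟩, rfl⟩, rfl⟩

variable [DecidableEq A]

theorem deriv_wordDeriv (e : RegularExpression A) (w : List A) (a : A) :
    (wordDeriv e w).deriv a = wordDeriv e (w ++ [a]) := by
  simp [wordDeriv]

theorem deriv_mem_closure {S : Set (RegularExpression A)}
    (hS : ∀ s ∈ S, ∀ a, s.deriv a ∈ AddSubsemigroup.closure S)
    {e : RegularExpression A} (he : e ∈ AddSubsemigroup.closure S) (a : A) :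
    e.deriv a ∈ AddSubsemigroup.closure S := by
  induction he using AddSubsemigroup.closure_induction with
  | mem e he => exact hS e he a
  | add e f _ _ he hf => exact add_mem he hf

/-- If the derivatives of elements of `S` are finite sums of elements of `S`, and `S` has
finitely many classes, then so have the word derivatives of any finite sum of elements of `S`. -/
theorem finite_wordDeriv_of_closure {S : Set (RegularExpression A)}
    (hfin : (toClass '' S).Finite)
    (hS : ∀ s ∈ S, ∀ a, s.deriv a ∈ AddSubsemigroup.closure S)
    {e : RegularExpression A} (he : e ∈ AddSubsemigroup.closure S) :
    (toClass '' Set.range (wordDeriv e)).Finite := by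
  refine (finite_toClass_image_closure hfin).subset (Set.image_mono ?_)
  rintro _ ⟨w, rfl⟩
  induction w generalizing e with
  | nil => exact he
  | cons a w ih => exact ih (deriv_mem_closure hS he a)

theorem deriv_mul_mem {M : AddSubsemigroup (RegularExpression A)}
    {e f : RegularExpression A} {a : A} (he : e.deriv a * f ∈ M) (hf : f.deriv a ∈ M) :
    (e * f).deriv a ∈ M := by
  change (RegularExpression.comp e f).deriv a ∈ M
  rw [RegularExpression.deriv]
  split_ifs
  · exact add_mem he hf
  · exact he

theorem finite_toClass_wordDeriv (e : RegularExpression A) :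
    (toClass '' Set.range (wordDeriv e)).Finite := by
  induction e with
  | zero =>
    refine finite_wordDeriv_of_closure (S := {0}) (Set.toFinite _) ?_
      (AddSubsemigroup.subset_closure rfl)
    rintro _ rfl a
    exact AddSubsemigroup.subset_closure rfl
  | epsilon =>
    refine finite_wordDeriv_of_closure (S := {0, 1}) (Set.toFinite _) ?_
      (AddSubsemigroup.subset_closure (.inr rfl))
    rintro _ (rfl | rfl) a <;> exact AddSubsemigroup.subset_closure (.inl rfl)
  | char b =>
    refine finite_wordDeriv_of_closure (S := {0, 1, .char b}) (Set.toFinite _) ?_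
      (AddSubsemigroup.subset_closure (.inr (.inr rfl)))
    rintro _ (rfl | rfl | rfl) a
    · exact AddSubsemigroup.subset_closure (.inl rfl)
    · exact AddSubsemigroup.subset_closure (.inl rfl)
    · rw [RegularExpression.deriv]
      split_ifs
      · exact AddSubsemigroup.subset_closure (.inr (.inl rfl))
      · exact AddSubsemigroup.subset_closure (.inl rfl)
  | plus e f he hf =>
    refine finite_wordDeriv_of_closure
      (S := Set.range (wordDeriv e) ∪ Set.range (wordDeriv f)) ?_ ?_
      (add_mem (AddSubsemigroup.subset_closure (.inl ⟨[], rfl⟩))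
        (AddSubsemigroup.subset_closure (.inr ⟨[], rfl⟩)))
    · rw [Set.image_union]
      exact he.union hf
    · rintro _ (⟨w, rfl⟩ | ⟨w, rfl⟩) a <;> rw [deriv_wordDeriv]
      · exact AddSubsemigroup.subset_closure (.inl ⟨_, rfl⟩)
      · exact AddSubsemigroup.subset_closure (.inr ⟨_, rfl⟩)
  | comp e f he hf =>
    refine finite_wordDeriv_of_closure
      (S := (Set.range fun w => wordDeriv e w * f) ∪ Set.range (wordDeriv f)) ?_ ?_
      (AddSubsemigroup.subset_closure (.inl ⟨[], rfl⟩))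
    · rw [Set.image_union]
      exact (finite_toClass_range_mul he f).union hf
    · rintro _ (⟨w, rfl⟩ | ⟨w, rfl⟩) a
      · refine deriv_mul_mem ?_ (AddSubsemigroup.subset_closure (.inr ⟨[a], rfl⟩))
        rw [deriv_wordDeriv]
        exact AddSubsemigroup.subset_closure (.inl ⟨_, rfl⟩)
      · rw [deriv_wordDeriv]
        exact AddSubsemigroup.subset_closure (.inr ⟨_, rfl⟩)
  | star e he =>
    have hstar (a : A) : e.star.deriv a ∈ AddSubsemigroup.closure
        ({e.star} ∪ Set.range fun w => wordDeriv e w * e.star) :=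
      AddSubsemigroup.subset_closure (.inr ⟨[a], rfl⟩)
    refine finite_wordDeriv_of_closure
      (S := {e.star} ∪ Set.range fun w => wordDeriv e w * e.star) ?_ ?_
      (AddSubsemigroup.subset_closure (.inl rfl))
    · rw [Set.image_union]
      exact (Set.toFinite _).union (finite_toClass_range_mul he e.star)
    · rintro _ (rfl | ⟨w, rfl⟩) a
      · exact hstar a
      · refine deriv_mul_mem ?_ (hstar a)
        rw [deriv_wordDeriv]
        exact AddSubsemigroup.subset_closure (.inr ⟨_, rfl⟩)

end ACI

/-- Finiteness of Brzozowski derivatives modulo ACI: every expression has only finitely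
many word derivatives up to the ACI congruence. -/
theorem finitely_many_derivatives_mod_aci {A : Type*} [Fintype A] [DecidableEq A]
    (e : RegularExpression A) :
    ∃ ρ : Finset (RegularExpression A),
      ∀ w : List A, ∃ e' ∈ ρ, ACI (wordDeriv e w) e' := by
  classical
  refine ⟨(ACI.finite_toClass_wordDeriv e).toFinset.image Quotient.out, fun w =>
    ⟨(ACI.toClass (wordDeriv e w)).out, ?_, ?_⟩⟩
  · refine Finset.mem_image_of_mem _ ((Set.Finite.mem_toFinset _).2 ?_)
    exact ⟨_, ⟨w, rfl⟩, rfl⟩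
  · exact ACI.toClass_eq_iff.1 (Quotient.out_eq _).symm
end

section
/- Expressions to automata (Brzozowski's construction): for every regular expression e over a finite alphabet A, there exists a finite deterministic automaton (S, ⟨o_S, t_S⟩) with a state s ∈ S whose recognized language equals the language of e, i.e., L(s) = ⟦e⟧. -/
/-- Word derivative of a state: `dst t s w` is the state reached from `s` by reading `w`. -/
def dst {S A : Type*} (t : S → A → S) : S → List A → S
  | s, [] => s
  | s, a :: w => dst t (t s a) w

/-- The language recognized by a state `s` of the automaton `(S, ⟨o, t⟩)`. -/
def lang {S A : Type*} (o : S → Bool) (t : S → A → S) (s : S) : Language A :=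
  {w : List A | o (dst t s w) = true}

namespace Language

open scoped Computability

variable {α : Type*} {L M : Language α}

theorem leftQuotient_mul (w : List α) :
    (L * M).leftQuotient w =
      L.leftQuotient w * M + sSup {K | ∃ u ∈ L, ∃ v, u ++ v = w ∧ M.leftQuotient v = K} := by
  ext x
  simp only [mem_leftQuotient, mem_add, mem_mul]
  constructor
  · rintro ⟨a, ha, b, hb, h⟩
    rcases List.append_eq_append_iff.mp h with ⟨c, rfl, rfl⟩ | ⟨c, rfl, rfl⟩
    · exact .inr ⟨_, ⟨a, ha, c, rfl, rfl⟩, hb⟩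
    · exact .inl ⟨c, ha, b, hb, rfl⟩
  · rintro (⟨a, ha, b, hb, rfl⟩ | ⟨_, ⟨u, hu, v, rfl, rfl⟩, hx⟩)
    · exact ⟨w ++ a, ha, b, hb, by simp⟩
    · exact ⟨u, hu, v ++ x, hx, by simp⟩

theorem append_mem_kstar {u v : List α} (hu : u ∈ L) (hv : v ∈ L∗) : u ++ v ∈ L∗ :=
  have h : L * L∗ ≤ L∗ := mul_kstar_le_kstar
  Set.mem_of_subset_of_mem h (mem_mul.mpr ⟨u, hu, v, hv, rfl⟩)

theorem exists_split_of_append_mem_kstar {w x : List α} (hw : w ≠ []) (h : w ++ x ∈ L∗) :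
    ∃ u ∈ L∗, ∃ v, u ++ v = w ∧ x ∈ L.leftQuotient v * L∗ := by
  obtain ⟨S, hS, hL⟩ := mem_kstar.mp h
  clear h
  induction S generalizing w with
  | nil => simp_all
  | cons l S ih =>
    have hl : l ∈ L := hL l (by simp)
    have hS' : ∀ y ∈ S, y ∈ L := fun y hy => hL y (by simp [hy])
    have hflat : S.flatten ∈ L∗ := mem_kstar.mpr ⟨S, rfl, hS'⟩
    rw [List.flatten_cons] at hS
    rcases List.append_eq_append_iff.mp hS with ⟨c, rfl, rfl⟩ | ⟨c, rfl, hc⟩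
    · exact ⟨[], nil_mem_kstar L, w, rfl, mem_mul.mpr ⟨c, hl, _, hflat, rfl⟩⟩
    · by_cases hc0 : c = []
      · subst hc0
        refine ⟨[], nil_mem_kstar L, l, by simp, mem_mul.mpr ⟨[], ?_, x, ?_, rfl⟩⟩
        · simpa using hl
        · rwa [hc, List.nil_append] at hflat
      · obtain ⟨u, hu, v, rfl, hx⟩ := ih hc0 hc.symm hS'
        refine ⟨l ++ u, ?_, v, by simp, hx⟩
        exact append_mem_kstar hl hu

theorem leftQuotient_kstar {w : List α} (hw : w ≠ []) :
    L∗.leftQuotient w =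
      sSup {K | ∃ u ∈ L∗, ∃ v, u ++ v = w ∧ L.leftQuotient v = K} * L∗ := by
  ext x
  rw [mem_leftQuotient]
  constructor
  · intro h
    obtain ⟨u, hu, v, huv, hx⟩ := exists_split_of_append_mem_kstar hw h
    obtain ⟨a, ha, b, hb, rfl⟩ := mem_mul.mp hx
    exact mem_mul.mpr ⟨a, ⟨_, ⟨u, hu, v, huv, rfl⟩, ha⟩, b, hb, rfl⟩
  · intro h
    obtain ⟨a, ⟨_, ⟨u, hu, v, rfl, rfl⟩, ha⟩, b, hb, rfl⟩ := mem_mul.mp h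
    have hvb : (v ++ a) ++ b ∈ L∗ := append_mem_kstar ha hb
    have := mem_mul.mpr ⟨u, hu, _, hvb, rfl⟩
    rw [kstar_mul_kstar] at this
    simpa using this

theorem IsRegular.mul (hL : L.IsRegular) (hM : M.IsRegular) : (L * M).IsRegular := by
  refine .of_finite_range_leftQuotient <| (Set.Finite.image2 (fun K C => K * M + sSup C)
    hL.finite_range_leftQuotient hM.finite_range_leftQuotient.powerset).subset ?_
  rintro _ ⟨w, rfl⟩
  refine ⟨_, ⟨w, rfl⟩, _, ?_, (leftQuotient_mul w).symm⟩
  rintro _ ⟨_, _, v, _, rfl⟩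
  exact ⟨v, rfl⟩

theorem IsRegular.kstar (hL : L.IsRegular) : L∗.IsRegular := by
  refine .of_finite_range_leftQuotient <| ((hL.finite_range_leftQuotient.powerset.image
    (fun C => sSup C * L∗)).insert L∗).subset ?_
  rintro _ ⟨w, rfl⟩
  by_cases hw : w = []
  · exact .inl (by simp [hw])
  · refine .inr ⟨_, ?_, (leftQuotient_kstar hw).symm⟩
    rintro _ ⟨_, _, v, _, rfl⟩
    exact ⟨v, rfl⟩

theorem isRegular_zero : (0 : Language α).IsRegular :=
  .of_finite_range_leftQuotient <| (Set.finite_singleton 0).subset <| by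
    rintro _ ⟨w, rfl⟩
    rfl

theorem isRegular_one : (1 : Language α).IsRegular := by
  have h : (1 : Language α) = 0∗ := by simp
  exact h ▸ isRegular_zero.kstar

theorem isRegular_singleton_letter (a : α) : ({[a]} : Language α).IsRegular := by
  refine .of_finite_range_leftQuotient <| (Set.toFinite {{[a]}, 1, 0}).subset ?_
  rintro _ ⟨w, rfl⟩
  rcases w with _ | ⟨b, w⟩
  · exact .inl rfl
  · by_cases h : b = a ∧ w = []
    · obtain ⟨rfl, rfl⟩ := h
      refine .inr (.inl ?_)
      ext x
      change [b] ++ x = [b] ↔ x = []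
      simp
    · refine .inr (.inr ?_)
      ext x
      change b :: w ++ x = [a] ↔ False
      simp only [List.cons_append, List.cons.injEq, List.append_eq_nil_iff, iff_false]
      tauto

end Language

theorem RegularExpression.isRegular_matches' {α : Type*} (e : RegularExpression α) :
    e.matches'.IsRegular := by
  induction e with
  | zero => exact Language.isRegular_zero
  | epsilon => exact Language.isRegular_one
  | char a => exact Language.isRegular_singleton_letter a
  | plus _ _ h₁ h₂ => exact h₁.add h₂
  | comp _ _ h₁ h₂ => exact h₁.mul h₂
  | star _ h => exact h.kstar

theorem dst_eq_evalFrom {A S : Type*} (M : DFA A S) (s : S) (w : List A) :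
    dst M.step s w = M.evalFrom s w := by
  induction w generalizing s with
  | nil => rfl
  | cons a w ih => exact ih (M.step s a)

/-- Brzozowski's construction: every regular expression is recognized by a state of a
finite deterministic automaton. -/
theorem expression_to_automaton {A : Type*} [Fintype A] [DecidableEq A]
    (e : RegularExpression A) :
    ∃ (S : Type) (_ : Fintype S) (o : S → Bool) (t : S → A → S) (s : S),
      lang o t s = e.matches' := by
  classical
  obtain ⟨S, hS, M, hM⟩ := Language.isRegular_iff.mp e.isRegular_matches'
  refine ⟨S, hS, fun s => decide (s ∈ M.accept), M.step, M.start, ?_⟩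
  rw [← hM]
  ext w
  change decide (dst M.step M.start w ∈ M.accept) = true ↔ M.evalFrom M.start w ∈ M.accept
  rw [decide_eq_true_iff, dst_eq_evalFrom]
end

section
/- Automata to expressions: for every finite deterministic automaton (S, ⟨o_S, t_S⟩) over a finite alphabet A and every state s ∈ S, there exists a regular expression e over A such that ⟦e⟧ = L(s). -/
/-- A language is rational if it is denoted by some regular expression. -/
def IsRational {A : Type*} (l : Language A) : Prop :=
  ∃ e : RegularExpression A, e.matches' = l

namespace IsRational

variable {A : Type*} {l m : Language A}

theorem zero : IsRational (0 : Language A) := ⟨0, rfl⟩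

theorem one : IsRational (1 : Language A) := ⟨1, rfl⟩

theorem letter (a : A) : IsRational ({[a]} : Language A) := ⟨.char a, rfl⟩

theorem add : IsRational l → IsRational m → IsRational (l + m) := by
  rintro ⟨e, rfl⟩ ⟨f, rfl⟩
  exact ⟨e + f, rfl⟩

theorem mul : IsRational l → IsRational m → IsRational (l * m) := by
  rintro ⟨e, rfl⟩ ⟨f, rfl⟩
  exact ⟨e * f, rfl⟩

theorem kstar : IsRational l → IsRational (KStar.kstar l) := by
  rintro ⟨e, rfl⟩
  exact ⟨e.star, rfl⟩

theorem sum {ι : Type*} {F : Finset ι} {f : ι → Language A} (h : ∀ i ∈ F, IsRational (f i)) :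
    IsRational (∑ i ∈ F, f i) :=
  Finset.sum_induction f IsRational (fun _ _ => add) zero h

end IsRational

theorem Language.mem_sum {A ι : Type*} (F : Finset ι) (f : ι → Language A) (w : List A) :
    w ∈ ∑ i ∈ F, f i ↔ ∃ i ∈ F, w ∈ f i := by
  classical
  induction F using Finset.induction_on with
  | empty => simp [Language.notMem_zero]
  | insert k F hk ih => simp [Finset.sum_insert hk, Language.mem_add, ih]

theorem Language.nil_mem_mul {A : Type*} (l m : Language A) :
    [] ∈ l * m ↔ [] ∈ l ∧ [] ∈ m := by
  simp [Language.mem_mul]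

/-- Solutions of a finite right-linear system of equations with rational coefficients, in which
the coefficients of the unknowns do not contain the empty word, are rational. -/
theorem IsRational.of_linear_system {A ι : Type*} (F : Finset ι) (x : ι → Language A)
    (M : ι → ι → Language A) (b : ι → Language A)
    (hM : ∀ i j, IsRational (M i j)) (hε : ∀ i j, [] ∉ M i j) (hb : ∀ i, IsRational (b i))
    (hx : ∀ i ∈ F, x i = ∑ j ∈ F, M i j * x j + b i) :
    ∀ i ∈ F, IsRational (x i) := by
  classical
  induction F using Finset.induction_on generalizing M b with
  | empty => simp
  | insert k F hk ih =>
    have hxk : x k = KStar.kstar (M k k) * (∑ j ∈ F, M k j * x j + b k) := by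
      rw [← Language.self_eq_mul_add_iff (hε k k), ← add_assoc,
        ← Finset.sum_insert (f := fun j => M k j * x j) hk]
      exact hx k (Finset.mem_insert_self k F)
    have hF : ∀ i ∈ F, IsRational (x i) := by
      refine ih (fun i j => M i j + M i k * (KStar.kstar (M k k) * M k j))
        (fun i => M i k * (KStar.kstar (M k k) * b k) + b i)
        (fun i j => (hM i j).add ((hM i k).mul ((hM k k).kstar.mul (hM k j))))
        (fun i j => ?_) (fun i => ((hM i k).mul ((hM k k).kstar.mul (hb k))).add (hb i))
        (fun i hi => ?_)
      · simp [Language.mem_add, Language.nil_mem_mul, hε]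
      · rw [hx i (Finset.mem_insert_of_mem hi), Finset.sum_insert hk]
        nth_rewrite 1 [hxk]
        simp only [mul_add, add_mul, Finset.mul_sum, Finset.sum_add_distrib, mul_assoc]
        abel
    have hk' : IsRational (x k) := by
      rw [hxk]
      exact (hM k k).kstar.mul ((IsRational.sum fun j hj => (hM k j).mul (hF j hj)).add (hb k))
    simpa [hk'] using hF

theorem lang_eq_sum_letter_mul_add {A : Type*} [Fintype A] {S : Type*}
    (o : S → Bool) (t : S → A → S) (s : S) :
    lang o t s = ∑ a, ({[a]} : Language A) * lang o t (t s a) + if o s then 1 else 0 := by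
  ext w
  rw [Language.mem_add, Language.mem_sum]
  cases w with
  | nil =>
    have hnil (a : A) : [] ∉ ({[a]} : Language A) := fun h => List.cons_ne_nil a [] h.symm
    have hlang : [] ∈ lang o t s ↔ o s = true := Iff.rfl
    by_cases ho : o s = true <;>
      simp [hlang, Language.nil_mem_mul, hnil, ho, Language.notMem_zero]
  | cons a w =>
    have hone : a :: w ∉ (if o s then 1 else 0 : Language A) := by
      split_ifs <;> simp [Language.mem_one, Language.notMem_zero]
    simp only [hone, or_false, Finset.mem_univ, true_and]
    constructor
    · exact fun h => ⟨a, [a], rfl, w, h, rfl⟩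
    · rintro ⟨c, _, rfl, v, hv, hcv⟩
      obtain ⟨rfl, rfl⟩ := List.cons.inj hcv
      exact hv

/-- Automata to expressions: every state of a finite deterministic automaton recognizes
the language of some regular expression. -/
theorem automaton_to_expression {A : Type*} [Fintype A] {S : Type*} [Fintype S]
    (o : S → Bool) (t : S → A → S) (s : S) :
    ∃ e : RegularExpression A, e.matches' = lang o t s := by
  classical
  refine IsRational.of_linear_system Finset.univ (lang o t)
    (fun i j => ∑ a, if t i a = j then ({[a]} : Language A) else 0)
    (fun i => if o i then 1 else 0) (fun i j => IsRational.sum fun a _ => ?_)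
    (fun i j => ?_) (fun i => ?_) (fun i _ => ?_) s (Finset.mem_univ s)
  · split_ifs
    exacts [.letter a, .zero]
  · rw [Language.mem_sum]
    rintro ⟨a, _, h⟩
    split_ifs at h
    · exact List.cons_ne_nil a [] h.symm
    · exact Language.notMem_zero _ h
  · split_ifs
    exacts [.one, .zero]
  · simp only [Finset.sum_mul]
    rw [Finset.sum_comm]
    simpa [ite_mul] using lang_eq_sum_letter_mul_add o t i
end

section
/- Soundness of solutions to automaton systems of equations: let (S, ⟨o_S, t_S⟩) be a deterministic automaton over a finite alphabet A and suppose that for each state s ∈ S a regular expression e_s is given such that ⟦e_s⟧ = ⟦o_S(s)⟧ ∪ ⋃_{a ∈ A} {a}·⟦e_{t_S s a}⟧ (where ⟦o_S(s)⟧ is {ε} if o_S(s) = 1 and ∅ otherwise). Then for every state s ∈ S, ⟦e_s⟧ = L(s). -/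
theorem Language.mem_singleton_mul_iff {A : Type*} {a : A} {L : Language A} {w : List A} :
    w ∈ ({[a]} : Language A) * L ↔ ∃ v ∈ L, a :: v = w := by
  rw [Language.mem_mul]
  constructor
  · rintro ⟨u, hu, v, hv, rfl⟩
    obtain rfl : u = [a] := hu
    exact ⟨v, hv, rfl⟩
  · rintro ⟨v, hv, rfl⟩
    exact ⟨[a], rfl, v, hv, rfl⟩

/-- Soundness of solutions to automaton systems of equations: if the expressions `e s`
form a solution to the system induced by the automaton, then each `e s` denotes the
language recognized by `s`. -/
theorem solution_sound {A : Type*} [Fintype A] {S : Type*}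
    (oS : S → Bool) (tS : S → A → S) (e : S → RegularExpression A)
    (hsol : ∀ s : S,
      (e s).matches' =
        (if oS s then (1 : Language A) else (0 : Language A)) +
          ⨆ a : A, ({[a]} : Language A) * (e (tS s a)).matches')
    (s : S) :
    (e s).matches' = lang oS tS s := by
  ext w
  induction w generalizing s with
  | nil =>
    rw [hsol, Language.mem_add, Language.mem_iSup]
    simp only [Language.mem_singleton_mul_iff]
    change _ ↔ oS s = true
    cases oS s <;> simp [Language.notMem_zero]
  | cons a w ih =>
    rw [hsol, Language.mem_add, Language.mem_iSup]
    simp only [Language.mem_singleton_mul_iff]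
    change _ ↔ w ∈ lang oS tS (tS s a)
    rw [← ih]
    cases oS s <;> simp [Language.notMem_zero, Language.mem_one]
end
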